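/- Let F be a field and let T ∈ F^{n1} ⊗ F^{n2} ⊗ F^{n3} be an order-three tensor. Then limsup_{m→∞} SR(T^{⊠m})^{1/m} ≥ Q~(T) ≥ (limsup_{m→∞} SR(T^{⊠m})^{1/m})^(2/3). -/

import Mathlib

open scoped BigOperators

namespace Paper

variable {F : Type*} [Field F]

/-- Restriction of order-three tensors: `T ≥ S` iff there exist linear maps
(given by matrices `L1, L2, L3`) carrying `T` to `S`. -/
def Restricts {ι1 ι2 ι3 κ1 κ2 κ3 : Type*} [Fintype ι1] [Fintype ι2] [Fintype ι3]
    (T : ι1 → ι2 → ι3 → F) (S : κ1 → κ2 → κ3 → F) : Prop :=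
  ∃ (L1 : κ1 → ι1 → F) (L2 : κ2 → ι2 → F) (L3 : κ3 → ι3 → F),
    ∀ a b c, S a b c = ∑ i, ∑ j, ∑ k, L1 a i * L2 b j * L3 c k * T i j k

/-- The unit (diagonal) tensor `⟨r⟩`. -/
def unitTensor (F : Type*) [Field F] (r : ℕ) : Fin r → Fin r → Fin r → F :=
  fun i j k => if i = j ∧ j = k then 1 else 0

/-- The subrank `Q(T)`: the largest `r` such that `T` restricts to `⟨r⟩`. -/
noncomputable def subrank {ι1 ι2 ι3 : Type*} [Fintype ι1] [Fintype ι2] [Fintype ι3]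
    (T : ι1 → ι2 → ι3 → F) : ℕ :=
  sSup {r : ℕ | Restricts T (unitTensor F r)}

/-- Kronecker (tensor) power `T^{⊠ m}` of an order-three tensor. -/
def kronPow {ι1 ι2 ι3 : Type*} (T : ι1 → ι2 → ι3 → F) (m : ℕ) :
    (Fin m → ι1) → (Fin m → ι2) → (Fin m → ι3) → F :=
  fun x y z => ∏ s : Fin m, T (x s) (y s) (z s)

/-- Asymptotic subrank `Q~(T) = lim_n Q(T^{⊠n})^{1/n} = sup_n Q(T^{⊠n})^{1/n}`. -/
noncomputable def asympSubrank {ι1 ι2 ι3 : Type*} [Fintype ι1] [Fintype ι2] [Fintype ι3]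
    (T : ι1 → ι2 → ι3 → F) : ℝ :=
  ⨆ m : ℕ, (subrank (kronPow T (m + 1)) : ℝ) ^ ((1 : ℝ) / (m + 1))

/-- First flattening of a tensor. -/
def flattening1 {ι1 ι2 ι3 : Type*} (T : ι1 → ι2 → ι3 → F) : Matrix ι1 (ι2 × ι3) F :=
  Matrix.of fun i p => T i p.1 p.2

/-- Second flattening of a tensor. -/
def flattening2 {ι1 ι2 ι3 : Type*} (T : ι1 → ι2 → ι3 → F) : Matrix ι2 (ι1 × ι3) F :=
  Matrix.of fun j p => T p.1 j p.2

/-- Third flattening of a tensor. -/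
def flattening3 {ι1 ι2 ι3 : Type*} (T : ι1 → ι2 → ι3 → F) : Matrix ι3 (ι1 × ι2) F :=
  Matrix.of fun k p => T p.1 p.2 k

/-- A tensor is concise if all three flattening ranks are maximal. -/
noncomputable def Concise {ι1 ι2 ι3 : Type*} [Fintype ι1] [Fintype ι2] [Fintype ι3]
    (T : ι1 → ι2 → ι3 → F) : Prop :=
  (flattening1 T).rank = Fintype.card ι1 ∧
  (flattening2 T).rank = Fintype.card ι2 ∧
  (flattening3 T).rank = Fintype.card ι3

/-- A tensor has slice rank one if one of its flattenings has rank one. -/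
noncomputable def SliceRankOne {ι1 ι2 ι3 : Type*} [Fintype ι1] [Fintype ι2] [Fintype ι3]
    (T : ι1 → ι2 → ι3 → F) : Prop :=
  (flattening1 T).rank = 1 ∨ (flattening2 T).rank = 1 ∨ (flattening3 T).rank = 1

/-- The slice rank `SR(T)`: the least `r` such that `T` is a sum of `r` slice-rank-one
tensors. -/
noncomputable def sliceRank {ι1 ι2 ι3 : Type*} [Fintype ι1] [Fintype ι2] [Fintype ι3]
    (T : ι1 → ι2 → ι3 → F) : ℕ :=
  sInf {r : ℕ | ∃ f : Fin r → (ι1 → ι2 → ι3 → F),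
    (∀ t, SliceRankOne (f t)) ∧ T = ∑ t, f t}

/-- The liminf-asymptotic slice rank. -/
noncomputable def asympSliceRankInf {ι1 ι2 ι3 : Type*} [Fintype ι1] [Fintype ι2] [Fintype ι3]
    (T : ι1 → ι2 → ι3 → F) : ℝ :=
  Filter.liminf (fun m : ℕ => (sliceRank (kronPow T m) : ℝ) ^ ((1 : ℝ) / m)) Filter.atTop

/-- The limsup-asymptotic slice rank. -/
noncomputable def asympSliceRankSup {ι1 ι2 ι3 : Type*} [Fintype ι1] [Fintype ι2] [Fintype ι3]
    (T : ι1 → ι2 → ι3 → F) : ℝ :=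
  Filter.limsup (fun m : ℕ => (sliceRank (kronPow T m) : ℝ) ^ ((1 : ℝ) / m)) Filter.atTop

/-- The max-rank of a matrix subspace. -/
noncomputable def maxrank {m n : Type*} [Fintype n] (𝒜 : Submodule F (Matrix m n F)) : ℕ :=
  sSup {r : ℕ | ∃ A ∈ 𝒜, A.rank = r}

/-- The min-rank of a matrix subspace: the least rank of a nonzero element. -/
noncomputable def minrank {m n : Type*} [Fintype n] (𝒜 : Submodule F (Matrix m n F)) : ℕ :=
  sInf {r : ℕ | ∃ A ∈ 𝒜, A ≠ 0 ∧ A.rank = r}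

section Slices

variable {n1 n2 n3 : ℕ}

/-- Span of the 3-slices, rows indexed by direction 1, columns by direction 2. -/
def span12 (T : Fin n1 → Fin n2 → Fin n3 → F) : Submodule F (Matrix (Fin n1) (Fin n2) F) :=
  Submodule.span F (Set.range fun k : Fin n3 => Matrix.of fun i j => T i j k)

/-- Span of the 3-slices, rows indexed by direction 2, columns by direction 1. -/
def span21 (T : Fin n1 → Fin n2 → Fin n3 → F) : Submodule F (Matrix (Fin n2) (Fin n1) F) :=
  Submodule.span F (Set.range fun k : Fin n3 => Matrix.of fun j i => T i j k)

/-- Span of the 2-slices, rows indexed by direction 1, columns by direction 3. -/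
def span13 (T : Fin n1 → Fin n2 → Fin n3 → F) : Submodule F (Matrix (Fin n1) (Fin n3) F) :=
  Submodule.span F (Set.range fun j : Fin n2 => Matrix.of fun i k => T i j k)

/-- Span of the 2-slices, rows indexed by direction 3, columns by direction 1. -/
def span31 (T : Fin n1 → Fin n2 → Fin n3 → F) : Submodule F (Matrix (Fin n3) (Fin n1) F) :=
  Submodule.span F (Set.range fun j : Fin n2 => Matrix.of fun k i => T i j k)

/-- Span of the 1-slices, rows indexed by direction 2, columns by direction 3. -/
def span23 (T : Fin n1 → Fin n2 → Fin n3 → F) : Submodule F (Matrix (Fin n2) (Fin n3) F) :=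
  Submodule.span F (Set.range fun i : Fin n1 => Matrix.of fun j k => T i j k)

/-- Span of the 1-slices, rows indexed by direction 3, columns by direction 2. -/
def span32 (T : Fin n1 → Fin n2 → Fin n3 → F) : Submodule F (Matrix (Fin n3) (Fin n2) F) :=
  Submodule.span F (Set.range fun i : Fin n1 => Matrix.of fun k j => T i j k)

/-- `Q_1(T)`: max-rank of the span of the 1-slices. -/
noncomputable def Q1 (T : Fin n1 → Fin n2 → Fin n3 → F) : ℕ := maxrank (span23 T)

/-- `Q_2(T)`: max-rank of the span of the 2-slices. -/
noncomputable def Q2 (T : Fin n1 → Fin n2 → Fin n3 → F) : ℕ := maxrank (span13 T)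

/-- `Q_3(T)`: max-rank of the span of the 3-slices. -/
noncomputable def Q3 (T : Fin n1 → Fin n2 → Fin n3 → F) : ℕ := maxrank (span12 T)

end Slices

/-- `p` is the pivot of the matrix `A`: the lexicographically least position of a
nonzero entry. -/
def IsPivot {n1 n2 : ℕ} (A : Matrix (Fin n1) (Fin n2) F) (p : Fin n1 × Fin n2) : Prop :=
  A p.1 p.2 ≠ 0 ∧ ∀ q : Fin n1 × Fin n2, A q.1 q.2 ≠ 0 → p.1 < q.1 ∨ (p.1 = q.1 ∧ p.2 ≤ q.2)

/-- The set of pivots of a matrix subspace (equal to the pivots of any basis with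
pairwise distinct pivots). -/
def pivotSet {n1 n2 : ℕ} (𝒜 : Submodule F (Matrix (Fin n1) (Fin n2) F)) :
    Set (Fin n1 × Fin n2) :=
  {p | ∃ A ∈ 𝒜, IsPivot A p}

/-- `ρ(𝒜)`: the least `r = |S1| + |S2|` such that the pivots of `𝒜` are covered by the
rows `S1` and columns `S2`. -/
noncomputable def rho {n1 n2 : ℕ} (𝒜 : Submodule F (Matrix (Fin n1) (Fin n2) F)) : ℕ :=
  sInf {r : ℕ | ∃ (S1 : Finset (Fin n1)) (S2 : Finset (Fin n2)),
    S1.card + S2.card = r ∧ ∀ p ∈ pivotSet 𝒜, p.1 ∈ S1 ∨ p.2 ∈ S2}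

/-- The border subrank `Q̲(T)`: the largest `r` such that, over Laurent polynomials
in `ε`, some restriction of `T` equals `⟨r⟩ + ε S_1 + ⋯ + ε^t S_t`. -/
noncomputable def borderSubrank {ι1 ι2 ι3 : Type*} [Fintype ι1] [Fintype ι2] [Fintype ι3]
    (T : ι1 → ι2 → ι3 → F) : ℕ :=
  sSup {r : ℕ |
    ∃ (A : Fin r → ι1 → LaurentPolynomial F) (B : Fin r → ι2 → LaurentPolynomial F)
      (C : Fin r → ι3 → LaurentPolynomial F) (t : ℕ)
      (S : Fin t → (Fin r → Fin r → Fin r → F)),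
      ∀ a b c,
        (∑ i, ∑ j, ∑ k, A a i * B b j * C c k * LaurentPolynomial.C (T i j k)) =
          LaurentPolynomial.C (unitTensor F r a b c) +
            ∑ s : Fin t, LaurentPolynomial.T (((s : ℕ) : ℤ) + 1) *
              LaurentPolynomial.C (S s a b c)}

/-- The linear map `A ↦ U * A * V` on rectangular matrices. -/
def conjMap {n1 n2 : ℕ} (U : Matrix (Fin n1) (Fin n1) F) (V : Matrix (Fin n2) (Fin n2) F) :
    Matrix (Fin n1) (Fin n2) F →ₗ[F] Matrix (Fin n1) (Fin n2) F where
  toFun A := U * A * V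
  map_add' A B := by simp [Matrix.mul_add, Matrix.add_mul]
  map_smul' c A := by simp [Matrix.mul_smul, Matrix.smul_mul]

/-- The principal submatrix `A_{J×J}`, where `J ⊆ [min{n1,n2}]` is encoded by the
map `η`. -/
def restrictJJ {n1 n2 jn : ℕ} (η : Fin jn → Fin (min n1 n2))
    (A : Matrix (Fin n1) (Fin n2) F) : Matrix (Fin jn) (Fin jn) F :=
  Matrix.of fun p q =>
    A (Fin.castLE (min_le_left n1 n2) (η p)) (Fin.castLE (min_le_right n1 n2) (η q))

/-- An order-three tensor over `F` of arbitrary format. -/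
structure Tensor3 (F : Type*) [Field F] where
  n1 : ℕ
  n2 : ℕ
  n3 : ℕ
  coef : Fin n1 → Fin n2 → Fin n3 → F

/-- Two tensors are equivalent if each restricts to the other. -/
def Tensor3.Equivalent (T S : Tensor3 F) : Prop :=
  Restricts T.coef S.coef ∧ Restricts S.coef T.coef

/-- A rank-one order-`k` tensor: a tensor product of `k` nonzero vectors. -/
def RankOne {k : ℕ} {ι : Fin k → Type*} (T : ((i : Fin k) → ι i) → F) : Prop :=
  ∃ u : (i : Fin k) → (ι i → F), (∀ i, u i ≠ 0) ∧ ∀ v, T v = ∏ i, u i (v i)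

/-- The tensor rank of an order-`k` tensor. -/
noncomputable def tensorRank {k : ℕ} {ι : Fin k → Type*} (T : ((i : Fin k) → ι i) → F) : ℕ :=
  sInf {r : ℕ | ∃ f : Fin r → (((i : Fin k) → ι i) → F),
    (∀ t, RankOne (f t)) ∧ T = ∑ t, f t}

/-- Kronecker power of an order-`k` tensor. -/
def kronPowK {k : ℕ} {ι : Fin k → Type*} (T : ((i : Fin k) → ι i) → F) (m : ℕ) :
    ((i : Fin k) → (Fin m → ι i)) → F :=
  fun v => ∏ s : Fin m, T fun i => v i s

/-- The asymptotic rank `R~(T) = lim_n R(T^{⊠n})^{1/n} = inf_n R(T^{⊠n})^{1/n}`. -/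
noncomputable def asympRank {k : ℕ} {ι : Fin k → Type*} (T : ((i : Fin k) → ι i) → F) : ℝ :=
  ⨅ m : ℕ, (tensorRank (kronPowK T (m + 1)) : ℝ) ^ ((1 : ℝ) / (m + 1))

section MatrixRank

variable {m n : Type*} [Fintype n]

theorem rank_add_le (A B : Matrix m n F) : (A + B).rank ≤ A.rank + B.rank := by
  refine le_trans (Submodule.finrank_mono ?_) (Submodule.finrank_add_le_finrank_add_finrank
    (LinearMap.range A.mulVecLin) (LinearMap.range B.mulVecLin))
  rintro _ ⟨y, rfl⟩
  rw [Matrix.mulVecLin_add]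
  exact Submodule.add_mem_sup ⟨y, rfl⟩ ⟨y, rfl⟩

theorem rank_neg_le (A : Matrix m n F) : (-A).rank ≤ A.rank := by
  refine Submodule.finrank_mono ?_
  rintro _ ⟨y, rfl⟩
  exact ⟨-y, by simp [Matrix.mulVec_neg]⟩

theorem eq_zero_of_rank_eq_zero {A : Matrix m n F} (h : A.rank = 0) : A = 0 := by
  have h1 : LinearMap.range A.mulVecLin = ⊥ := Submodule.finrank_eq_zero.1 h
  classical
  refine Matrix.mulVec_injective (funext fun v => ?_)
  have h2 : A.mulVec v ∈ LinearMap.range A.mulVecLin := ⟨v, rfl⟩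
  rw [h1, Submodule.mem_bot] at h2
  rw [h2, Matrix.zero_mulVec]

variable [Fintype m]

/-- Every matrix can be brought to an identity matrix of size its rank. -/
theorem exists_mul_mul_eq_one [DecidableEq m]    (Z : Matrix m n F) :
    ∃ (V : Matrix (Fin Z.rank) m F) (U : Matrix n (Fin Z.rank) F), V * Z * U = 1 := by
  let b : Module.Basis (Fin Z.rank) F (LinearMap.range Z.mulVecLin) := Module.finBasis F _
  choose u hu using fun t => (b t).2
  let U : Matrix n (Fin Z.rank) F := Matrix.of fun j t => u t j
  have hcol : (Z * U).col = fun t => (b t : m → F) := by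
    funext t
    rw [← hu t]
    rfl
  have hinj : Function.Injective (Z * U).mulVec := by
    rw [Matrix.mulVec_injective_iff, hcol]
    exact b.linearIndependent.map' (Submodule.subtype _) (Submodule.ker_subtype _)
  obtain ⟨g, hg⟩ := LinearMap.exists_leftInverse_of_injective (Z * U).mulVecLin
    (LinearMap.ker_eq_bot.2 hinj)
  refine ⟨LinearMap.toMatrix' g, U, ?_⟩
  rw [Matrix.mul_assoc, ← LinearMap.toMatrix'_toLin' (Z * U), ← LinearMap.toMatrix'_comp,
    Matrix.toLin'_apply', hg,
    LinearMap.toMatrix'_id]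

/-- Wedderburn rank reduction. -/
theorem rank_sub_add_le {s : ℕ} (X : Matrix m n F)
    (V : Matrix (Fin s) m F) (U : Matrix n (Fin s) F) (h : V * X * U = 1) :
    (X - X * U * V * X).rank + s ≤ X.rank := by
  let f : LinearMap.range X.mulVecLin →ₗ[F] (Fin s → F) :=
    V.mulVecLin ∘ₗ (LinearMap.range X.mulVecLin).subtype
  have hf : LinearMap.range f = ⊤ := by
    rw [LinearMap.range_eq_top]
    intro y
    refine ⟨⟨X.mulVec (U.mulVec y), U.mulVec y, rfl⟩, ?_⟩
    simp [f, Matrix.mulVec_mulVec, ← Matrix.mul_assoc, h]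
  have hdim := f.finrank_range_add_finrank_ker
  rw [hf, finrank_top, Module.finrank_fin_fun] at hdim
  have hV : V * (X - X * U * V * X) = 0 := by
    have : V * (X * U * V * X) = (V * X * U) * (V * X) := by simp only [Matrix.mul_assoc]
    rw [Matrix.mul_sub, this, h, Matrix.one_mul, sub_self]
  have hle : LinearMap.range (X - X * U * V * X).mulVecLin ≤
      (LinearMap.ker f).map (LinearMap.range X.mulVecLin).subtype := by
    rintro _ ⟨y, rfl⟩
    refine ⟨⟨(X - X * U * V * X).mulVec y, y - (U * V * X).mulVec y, ?_⟩, ?_, rfl⟩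
    · simp [Matrix.sub_mulVec, Matrix.mulVec_sub, Matrix.mul_assoc]
    · simp [f, hV]
  have h1 := (Submodule.finrank_mono hle).trans (Submodule.finrank_map_le _ _)
  change Module.finrank F _ + s ≤ Module.finrank F _
  omega

/-- If `A` has rank `r` and the ranks of `X` and `A + X` are at most `r`, then the part of `X`
complementary to `A` has rank at most `r / 2`. -/
theorem two_mul_le_rank {s : ℕ} (A X : Matrix m n F)
    (V : Matrix (Fin s) m F) (U : Matrix n (Fin s) F) (hX : X.rank ≤ A.rank)
    (hAX : (A + X).rank ≤ A.rank) (hVA : V * A = 0) (hAU : A * U = 0) (h : V * X * U = 1) :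
    2 * s ≤ A.rank := by
  have h1 := rank_sub_add_le X V U h
  have h2 := rank_sub_add_le (A + X) V U (by rw [Matrix.mul_add, hVA, zero_add, h])
  have h3 : A = (A + X - (A + X) * U * V * (A + X)) + -(X - X * U * V * X) := by
    have : (A + X) * U * V * (A + X) = X * U * V * X := by
      rw [Matrix.add_mul, hAU, zero_add, Matrix.mul_assoc, Matrix.mul_add, hVA, zero_add,
        ← Matrix.mul_assoc]
    rw [this]
    simp
  have h4 := rank_add_le (A + X - (A + X) * U * V * (A + X))
    (-(X - X * U * V * X))
  rw [← h3] at h4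
  have h5 := rank_neg_le (X - X * U * V * X)
  omega

theorem exists_compression [DecidableEq m] [DecidableEq n]
    (r : ℕ) (𝒜 : Submodule F (Matrix m n F)) (h𝒜 : ∀ A ∈ 𝒜, A.rank ≤ r) :
    ∃ (P : Matrix m m F) (Q : Matrix n n F), P.rank ≤ 2 * r ∧ Q.rank ≤ 2 * r ∧
      ∀ A ∈ 𝒜, (1 - P) * A * (1 - Q) = 0 := by
  induction r using Nat.strong_induction_on generalizing 𝒜 with
  | _ r ih =>
  rcases Nat.eq_zero_or_pos r with rfl | hr
  · exact ⟨0, 0, by simp, by simp, fun A hA => by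
      rw [eq_zero_of_rank_eq_zero (Nat.le_zero.1 (h𝒜 A hA))]; simp⟩
  by_cases hex : ∃ A ∈ 𝒜, A.rank = r
  · obtain ⟨A, hA, hAr⟩ := hex
    obtain ⟨V, U, hVU⟩ := exists_mul_mul_eq_one A
    have hAUVA : A * U * V * A = A := by
      have := rank_sub_add_le A V U hVU
      exact (sub_eq_zero.1 (eq_zero_of_rank_eq_zero (by omega))).symm
    set P₀ : Matrix m m F := A * U * V with hP₀
    set Q₀ : Matrix n n F := U * (V * A) with hQ₀
    have hP₀r : P₀.rank ≤ r := by
      rw [← hAr, hP₀, Matrix.mul_assoc]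
      exact Matrix.rank_mul_le_left _ _
    have hQ₀r : Q₀.rank ≤ r := by
      rw [← hAr, hQ₀, ← Matrix.mul_assoc]
      exact Matrix.rank_mul_le_right _ _
    have hPA : (1 - P₀) * A = 0 := by rw [Matrix.sub_mul, hAUVA, Matrix.one_mul, sub_self]
    have hAQ : A * (1 - Q₀) = 0 := by
      rw [Matrix.mul_sub, hQ₀, ← Matrix.mul_assoc, ← Matrix.mul_assoc, hAUVA, Matrix.mul_one,
        sub_self]
    let φ : Matrix m n F →ₗ[F] Matrix m n F :=
      { toFun := fun X => (1 - P₀) * X * (1 - Q₀)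
        map_add' := fun X Y => by rw [Matrix.mul_add, Matrix.add_mul]
        map_smul' := fun c X => by rw [Matrix.mul_smul, Matrix.smul_mul]; rfl }
    obtain ⟨P, Q, hP, hQ, hPQ⟩ := ih (r / 2) (by omega) (𝒜.map φ) (by
      rintro _ ⟨X, hX, rfl⟩
      change ((1 - P₀) * X * (1 - Q₀)).rank ≤ r / 2
      obtain ⟨V', U', h'⟩ := exists_mul_mul_eq_one ((1 - P₀) * X * (1 - Q₀))
      have := two_mul_le_rank A X (V' * (1 - P₀)) ((1 - Q₀) * U') (hAr ▸ h𝒜 X hX)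
        (hAr ▸ h𝒜 _ (𝒜.add_mem hA hX)) (by rw [Matrix.mul_assoc V', hPA, Matrix.mul_zero])
        (by rw [← Matrix.mul_assoc A, hAQ, Matrix.zero_mul])
        (by simpa only [Matrix.mul_assoc] using h')
      omega)
    refine ⟨P₀ + P * (1 - P₀), Q₀ + (1 - Q₀) * Q, ?_, ?_, fun X hX => ?_⟩
    · have h1 := rank_add_le P₀ (P * (1 - P₀))
      have h2 := Matrix.rank_mul_le_left P (1 - P₀)
      omega
    · have h1 := rank_add_le Q₀ ((1 - Q₀) * Q)
      have h2 := Matrix.rank_mul_le_right (1 - Q₀) Q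
      omega
    · have h1 : 1 - (P₀ + P * (1 - P₀)) = (1 - P) * (1 - P₀) := by noncomm_ring
      have h2 : 1 - (Q₀ + (1 - Q₀) * Q) = (1 - Q₀) * (1 - Q) := by noncomm_ring
      have h3 : (1 - P) * ((1 - P₀) * X * (1 - Q₀)) * (1 - Q) = 0 := hPQ _ ⟨X, hX, rfl⟩
      rw [h1, h2, ← h3]
      simp only [Matrix.mul_assoc]
  · obtain ⟨P, Q, hP, hQ, hPQ⟩ := ih (r - 1) (by omega) 𝒜 fun A hA => by
      have h1 := h𝒜 A hA
      have h2 : A.rank ≠ r := fun h => hex ⟨A, hA, h⟩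
      omega
    exact ⟨P, Q, by omega, by omega, hPQ⟩

end MatrixRank

section Slices

variable {ι1 ι2 ι3 : Type*}

/-- A tensor with some flattening rank at most one. -/
def IsSlice (T : ι1 → ι2 → ι3 → F) : Prop :=
  (∃ (a : ι1 → F) (b : ι2 → ι3 → F), T = fun i j k => a i * b j k) ∨
  (∃ (a : ι2 → F) (b : ι1 → ι3 → F), T = fun i j k => a j * b i k) ∨
  (∃ (a : ι3 → F) (b : ι1 → ι2 → F), T = fun i j k => a k * b i j)

/-- Cyclic rotation of the legs of a tensor. -/
def rotate (T : ι1 → ι2 → ι3 → F) : ι2 → ι3 → ι1 → F := fun j k i => T i j k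

theorem IsSlice.of_rotate {T : ι1 → ι2 → ι3 → F} (h : IsSlice (rotate T)) : IsSlice T := by
  rcases h with ⟨a, b, h⟩ | ⟨a, b, h⟩ | ⟨a, b, h⟩
  · exact Or.inr (Or.inl ⟨a, fun i k => b k i, funext fun i => funext fun j => funext fun k =>
      congrFun (congrFun (congrFun h j) k) i⟩)
  · exact Or.inr (Or.inr ⟨a, fun i j => b j i, funext fun i => funext fun j => funext fun k =>
      congrFun (congrFun (congrFun h j) k) i⟩)
  · exact Or.inl ⟨a, b, funext fun i => funext fun j => funext fun k =>
      congrFun (congrFun (congrFun h j) k) i⟩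

theorem sum_slices [Fintype ι1] [DecidableEq ι1] (T : ι1 → ι2 → ι3 → F) :
    T = ∑ t, fun i j k => (Pi.single t 1 : ι1 → F) i * T t j k := by
  funext i j k
  simp [Finset.sum_apply, Pi.single_apply]

variable [Fintype ι1] [Fintype ι2] [Fintype ι3]

theorem exists_eq_mul_of_rank_eq_one {m n : Type*} [Fintype m] [Fintype n] {A : Matrix m n F}
    (h : A.rank = 1) : ∃ (a : m → F) (b : n → F), ∀ i j, A i j = a i * b j := by
  classical
  obtain ⟨V, U, hVU⟩ := exists_mul_mul_eq_one A
  have h1 := rank_sub_add_le A V U hVU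
  have h2 := sub_eq_zero.1 (eq_zero_of_rank_eq_zero
    (A := A - A * U * V * A) (by omega))
  let t : Fin A.rank := ⟨0, by omega⟩
  have hs : Subsingleton (Fin A.rank) := by rw [h]; infer_instance
  refine ⟨fun i => (A * U) i t, fun j => (V * A) t j, fun i j => ?_⟩
  conv_lhs => rw [h2, Matrix.mul_assoc, Matrix.mul_apply]
  exact Fintype.sum_subsingleton _ t

theorem rank_le_one_of_eq_mul {m n : Type*} [Fintype n] {A : Matrix m n F} (a : m → F)
    (b : n → F) (h : ∀ i j, A i j = a i * b j) : A.rank ≤ 1 := by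
  have : A = Matrix.vecMulVec a b := by
    ext i j
    exact h i j
  rw [this]
  exact Matrix.rank_vecMulVec_le a b

theorem SliceRankOne.isSlice {T : ι1 → ι2 → ι3 → F} (h : SliceRankOne T) : IsSlice T := by
  rcases h with h | h | h
  · obtain ⟨a, b, hab⟩ := exists_eq_mul_of_rank_eq_one h
    exact Or.inl ⟨a, fun j k => b (j, k), funext fun i => funext fun j => funext fun k =>
      hab i (j, k)⟩
  · obtain ⟨a, b, hab⟩ := exists_eq_mul_of_rank_eq_one h
    exact Or.inr (Or.inl ⟨a, fun i k => b (i, k), funext fun i => funext fun j => funext fun k =>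
      hab j (i, k)⟩)
  · obtain ⟨a, b, hab⟩ := exists_eq_mul_of_rank_eq_one h
    exact Or.inr (Or.inr ⟨a, fun i j => b (i, j), funext fun i => funext fun j => funext fun k =>
      hab k (i, j)⟩)

theorem IsSlice.sliceRankOne {T : ι1 → ι2 → ι3 → F} (h : IsSlice T) (hT : T ≠ 0) :
    SliceRankOne T := by
  have h1 : ∀ r : ℕ, r ≤ 1 → r ≠ 0 → r = 1 := by omega
  rcases h with ⟨a, b, h⟩ | ⟨a, b, h⟩ | ⟨a, b, h⟩
  · refine Or.inl (h1 _ (rank_le_one_of_eq_mul a (fun p => b p.1 p.2) fun i p => ?_) fun h0 =>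
      hT (funext fun i => funext fun j => funext fun k =>
        congrFun (congrFun (eq_zero_of_rank_eq_zero h0) i) (j, k)))
    rw [h]; rfl
  · refine Or.inr (Or.inl (h1 _ (rank_le_one_of_eq_mul a (fun p => b p.1 p.2) fun i p => ?_)
      fun h0 => hT (funext fun i => funext fun j => funext fun k =>
        congrFun (congrFun (eq_zero_of_rank_eq_zero h0) j) (i, k))))
    rw [h]; rfl
  · refine Or.inr (Or.inr (h1 _ (rank_le_one_of_eq_mul a (fun p => b p.1 p.2) fun i p => ?_)
      fun h0 => hT (funext fun i => funext fun j => funext fun k =>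
        congrFun (congrFun (eq_zero_of_rank_eq_zero h0) k) (i, j))))
    rw [h]; rfl

theorem exists_sliceRankOne_sum {τ : Type*} [Fintype τ] (f : τ → ι1 → ι2 → ι3 → F)
    (hf : ∀ t, IsSlice (f t)) : ∃ r ≤ Fintype.card τ, ∃ g : Fin r → ι1 → ι2 → ι3 → F,
      (∀ t, SliceRankOne (g t)) ∧ ∑ t, f t = ∑ t, g t := by
  classical
  let e := (Fintype.equivFin {t // f t ≠ 0}).symm
  refine ⟨_, Fintype.card_subtype_le fun t => f t ≠ 0, fun t => f (e t),
    fun t => (hf _).sliceRankOne (e t).2, ?_⟩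
  rw [e.sum_comp fun t => f t.1, ← Finset.sum_filter_ne_zero,
    Finset.sum_subtype (p := fun t => f t ≠ 0) (Finset.univ.filter fun t => f t ≠ 0) (by simp)]

theorem sliceRank_le_card {τ : Type*} [Fintype τ] (f : τ → ι1 → ι2 → ι3 → F)
    (hf : ∀ t, IsSlice (f t)) : sliceRank (∑ t, f t) ≤ Fintype.card τ := by
  obtain ⟨r, hr, g, hg, hfg⟩ := exists_sliceRankOne_sum f hf
  have h : sliceRank (∑ t, f t) ≤ r := Nat.sInf_le ⟨g, hg, hfg⟩
  exact h.trans hr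

theorem sliceRank_le_card_left (T : ι1 → ι2 → ι3 → F) : sliceRank T ≤ Fintype.card ι1 := by
  classical
  conv_lhs => rw [sum_slices T]
  exact sliceRank_le_card _ fun t => Or.inl ⟨_, T t, rfl⟩

theorem exists_isSlice_sum (T : ι1 → ι2 → ι3 → F) :
    ∃ f : Fin (sliceRank T) → ι1 → ι2 → ι3 → F, (∀ t, IsSlice (f t)) ∧ T = ∑ t, f t := by
  classical
  have hne : {r : ℕ | ∃ f : Fin r → (ι1 → ι2 → ι3 → F),
      (∀ t, SliceRankOne (f t)) ∧ T = ∑ t, f t}.Nonempty := by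
    obtain ⟨r, -, g, hg, h⟩ := exists_sliceRankOne_sum
      (fun t => fun i j k => (Pi.single t 1 : ι1 → F) i * T t j k)
      fun t => Or.inl ⟨_, T t, rfl⟩
    exact ⟨r, g, hg, (sum_slices T).trans h⟩
  obtain ⟨f, hf, h⟩ := Nat.sInf_mem hne
  exact ⟨f, fun t => (hf t).isSlice, h⟩

theorem sliceRank_le_sliceRank_rotate (T : ι1 → ι2 → ι3 → F) :
    sliceRank T ≤ sliceRank (rotate T) := by
  obtain ⟨f, hf, h⟩ := exists_isSlice_sum (rotate T)
  have hT : T = ∑ t, fun i j k => f t j k i := by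
    funext i j k
    have := congrFun (congrFun (congrFun h j) k) i
    simpa [Finset.sum_apply, rotate] using this
  conv_lhs => rw [hT]
  simpa using sliceRank_le_card (fun t => fun i j k => f t j k i) fun t => (hf t).of_rotate

/-- The contraction of the third leg of a tensor. -/
def contract (T : ι1 → ι2 → ι3 → F) (c : ι3 → F) : Matrix ι1 ι2 F :=
  Matrix.of fun i j => ∑ k, c k * T i j k

/-- Some contraction of the third leg has rank at least a quarter of the slice rank. -/
theorem exists_sliceRank_le_rank_contract (T : ι1 → ι2 → ι3 → F) :
    ∃ c : ι3 → F, sliceRank T ≤ 4 * (contract T c).rank := by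
  classical
  let φ : (ι3 → F) →ₗ[F] Matrix ι1 ι2 F :=
    { toFun := contract T
      map_add' := fun c d => by ext i j; simp [contract, add_mul, Finset.sum_add_distrib]
      map_smul' := fun c d => by ext i j; simp [contract, Finset.mul_sum, mul_assoc] }
  obtain ⟨r, ⟨c, hc⟩, hr⟩ : ∃ r, (∃ c, (contract T c).rank = r) ∧
      ∀ c, (contract T c).rank ≤ r := by
    have hb : BddAbove (Set.range fun c => (contract T c).rank) :=
      ⟨Fintype.card ι2, by rintro _ ⟨c, rfl⟩; exact Matrix.rank_le_card_width _⟩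
    exact ⟨_, Nat.sSup_mem (Set.range_nonempty _) hb, fun c => le_csSup hb ⟨c, rfl⟩⟩
  refine ⟨c, ?_⟩
  obtain ⟨P, Q, hP, hQ, hPQ⟩ := exists_compression r (LinearMap.range φ)
    (by rintro _ ⟨c, rfl⟩; exact hr c)
  obtain ⟨V, U, hVU⟩ := exists_mul_mul_eq_one P
  obtain ⟨V', U', hVU'⟩ := exists_mul_mul_eq_one Q
  have hP' : P = P * U * (V * P) := by
    have := rank_sub_add_le P V U hVU
    rw [← Matrix.mul_assoc]
    exact sub_eq_zero.1 (eq_zero_of_rank_eq_zero (by omega))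
  have hQ' : Q = Q * U' * (V' * Q) := by
    have := rank_sub_add_le Q V' U' hVU'
    rw [← Matrix.mul_assoc]
    exact sub_eq_zero.1 (eq_zero_of_rank_eq_zero (by omega))
  let M : ι3 → Matrix ι1 ι2 F := fun k => Matrix.of fun i j => T i j k
  have hM : ∀ k, M k = P * U * (V * P * M k) + (1 - P) * M k * (Q * U') * (V' * Q) := by
    intro k
    have h1 : (1 - P) * M k * (1 - Q) = 0 := hPQ _ ⟨Pi.single k 1, by
      ext i j
      simp [φ, contract, M, Pi.single_apply]⟩
    have h2 : M k = P * M k + (1 - P) * M k * Q := by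
      rw [Matrix.mul_sub, Matrix.mul_one, sub_eq_zero] at h1
      rw [← h1, Matrix.sub_mul, Matrix.one_mul, add_sub_cancel]
    rw [← Matrix.mul_assoc (P * U), ← hP', Matrix.mul_assoc _ (Q * U'), ← hQ']
    exact h2
  let N : ι3 → Matrix ι1 (Fin Q.rank) F := fun k => (1 - P) * M k * (Q * U')
  let f : Fin P.rank ⊕ Fin Q.rank → ι1 → ι2 → ι3 → F := Sum.elim
    (fun t i j k => (P * U) i t * (V * P * M k) t j)
    (fun t i j k => (V' * Q) t j * N k i t)
  have hT : T = ∑ t, f t := by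
    funext i j k
    have h1 : T i j k = M k i j := rfl
    rw [h1, hM k]
    simp only [f, Fintype.sum_sum_type, Sum.elim_inl, Sum.elim_inr, Finset.sum_apply,
      Matrix.add_apply]
    rw [Matrix.mul_apply, Matrix.mul_apply (N := V' * Q)]
    simp only [N, mul_comm]
  have h := sliceRank_le_card f (by
    rintro (t | t)
    · exact Or.inl ⟨_, fun j k => (V * P * M k) t j, rfl⟩
    · exact Or.inr (Or.inl ⟨_, fun i k => N k i t, rfl⟩))
  rw [← hT, Fintype.card_sum, Fintype.card_fin, Fintype.card_fin] at h
  omega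

/-- A third-leg contraction restricts to an identity matrix of a quarter of the slice rank. -/
theorem exists_contract_eq_one (T : ι1 → ι2 → ι3 → F) {q : ℕ} (hq : 4 * q ≤ sliceRank T) :
    ∃ (u : Fin q → ι1 → F) (v : Fin q → ι2 → F) (w : ι3 → F), ∀ a b,
      ∑ i, ∑ j, ∑ k, u a i * v b j * w k * T i j k = if a = b then 1 else 0 := by
  classical
  obtain ⟨c, hc⟩ := exists_sliceRank_le_rank_contract T
  obtain ⟨V, U, hVU⟩ := exists_mul_mul_eq_one (contract T c)
  have hqr : q ≤ (contract T c).rank := by omega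
  refine ⟨fun a i => V (Fin.castLE hqr a) i, fun b j => U j (Fin.castLE hqr b), c, fun a b => ?_⟩
  have h1 := congrFun (congrFun hVU (Fin.castLE hqr a)) (Fin.castLE hqr b)
  rw [Matrix.one_apply, Matrix.mul_assoc, Matrix.mul_apply] at h1
  simp only [Fin.castLE_inj] at h1
  rw [← h1]
  refine Finset.sum_congr rfl fun i _ => ?_
  rw [Matrix.mul_apply, Finset.mul_sum]
  refine Finset.sum_congr rfl fun j _ => ?_
  simp only [contract, Matrix.of_apply, Finset.mul_sum, Finset.sum_mul]
  exact Finset.sum_congr rfl fun k _ => by ring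

theorem exists_finrank_le_card_support {n : Type*} [Fintype n] [DecidableEq F]
    (W : Submodule F (n → F)) :
    ∃ v ∈ W, Module.finrank F W ≤ Fintype.card {i // v i ≠ 0} := by
  classical
  have hb : BddAbove (Set.range fun v : W => Fintype.card {i // v.1 i ≠ 0}) :=
    ⟨Fintype.card n, by rintro _ ⟨v, rfl⟩; exact Fintype.card_subtype_le _⟩
  obtain ⟨v, hv⟩ := Nat.sSup_mem (Set.range_nonempty _) hb
  have hmax : ∀ w : W, Fintype.card {i // w.1 i ≠ 0} ≤ Fintype.card {i // v.1 i ≠ 0} :=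
    fun w => (le_csSup hb ⟨w, rfl⟩).trans_eq hv.symm
  refine ⟨v, v.2, ?_⟩
  by_contra! hlt
  let L : W →ₗ[F] ({i // v.1 i ≠ 0} → F) := (LinearMap.funLeft F F Subtype.val).comp W.subtype
  obtain ⟨w, hw, hw0⟩ := Submodule.exists_mem_ne_zero_of_ne_bot
    (LinearMap.ker_ne_bot_of_finrank_lt (f := L) (by simpa using hlt))
  have hwv : ∀ i, v.1 i ≠ 0 → w.1 i = 0 := fun i hi => congrFun (LinearMap.mem_ker.1 hw) ⟨i, hi⟩
  obtain ⟨i₀, hi₀⟩ : ∃ i, w.1 i ≠ 0 := by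
    by_contra! h
    exact hw0 (Subtype.ext (funext h))
  have hvi₀ : v.1 i₀ = 0 := by
    by_contra h
    exact hi₀ (hwv i₀ h)
  refine (hmax (v + w)).not_gt ?_
  rw [Fintype.card_subtype, Fintype.card_subtype]
  refine Finset.card_lt_card (Finset.ssubset_iff_of_subset ?_ |>.2 ⟨i₀, ?_, ?_⟩)
  · intro i hi
    have hi' : v.1 i ≠ 0 := by simpa using hi
    simp [hwv i hi', hi']
  · simp [hvi₀, hi₀]
  · simp [hvi₀]

theorem le_of_unitTensor_eq_sum {n r : ℕ} (f : Fin r → Fin n → Fin n → Fin n → F)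
    (hf : ∀ t, IsSlice (f t)) (h : unitTensor F n = ∑ t, f t) : n ≤ r := by
  classical
  let τ : Finset (Fin r) := Finset.univ.filter fun t =>
    ∃ (a : Fin n → F) (b : Fin n → Fin n → F), f t = fun i j k => a k * b i j
  have hτ : ∀ t : τ, ∃ (a : Fin n → F) (b : Fin n → Fin n → F), f t = fun i j k => a k * b i j :=
    fun t => (Finset.mem_filter.1 t.2).2
  choose a b hab using hτ
  let L : (Fin n → F) →ₗ[F] (τ → F) := (Matrix.of a).mulVecLin
  obtain ⟨v, hv, hcard⟩ := exists_finrank_le_card_support (LinearMap.ker L)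
  have hdim := L.finrank_range_add_finrank_ker
  have hrange : Module.finrank F (LinearMap.range L) ≤ τ.card := by
    simpa using Submodule.finrank_le (LinearMap.range L)
  rw [Module.finrank_fin_fun] at hdim
  have hdiag : contract (unitTensor F n) v = Matrix.diagonal v := by
    ext i j
    by_cases hij : i = j
    · subst hij
      simp [contract, unitTensor]
    · simp [contract, unitTensor, hij]
  have hsum : contract (unitTensor F n) v = ∑ t, contract (f t) v := by
    ext i j
    simp only [contract, h, Matrix.of_apply, Finset.sum_apply, Matrix.sum_apply, Finset.mul_sum]
    exact Finset.sum_comm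
  have hrank : (∑ t, contract (f t) v).rank ≤ ∑ t, (contract (f t) v).rank :=
    Finset.le_sum_of_subadditive _ (by simp) rank_add_le _ _
  have hle : ∀ t, (contract (f t) v).rank ≤ if t ∈ τ then 0 else 1 := by
    intro t
    split_ifs with ht
    · have h0 : ∑ k, a ⟨t, ht⟩ k * v k = 0 := congrFun (LinearMap.mem_ker.1 hv) ⟨t, ht⟩
      have : contract (f t) v = 0 := by
        ext i j
        simp only [contract, hab ⟨t, ht⟩, Matrix.of_apply, Matrix.zero_apply]
        rw [← zero_mul (b ⟨t, ht⟩ i j), ← h0, Finset.sum_mul]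
        exact Finset.sum_congr rfl fun k _ => by ring
      simp [this]
    · rcases hf t with ⟨a, b, h⟩ | ⟨a, b, h⟩ | ⟨a, b, h⟩
      · refine rank_le_one_of_eq_mul a (fun j => ∑ k, v k * b j k) fun i j => ?_
        simp only [contract, h, Matrix.of_apply, Finset.mul_sum]
        exact Finset.sum_congr rfl fun k _ => by ring
      · refine rank_le_one_of_eq_mul (fun i => ∑ k, v k * b i k) a fun i j => ?_
        simp only [contract, h, Matrix.of_apply, Finset.sum_mul]
        exact Finset.sum_congr rfl fun k _ => by ring
      · exact absurd (Finset.mem_filter.2 ⟨Finset.mem_univ t, a, b, h⟩) ht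
  have hone := Finset.sum_le_sum fun t (_ : t ∈ Finset.univ) => hle t
  have hcount : (∑ t, if t ∈ τ then 0 else 1) + τ.card = r := by
    have h1 : τ.card = ∑ t, if t ∈ τ then 1 else 0 := by simp
    rw [h1, ← Finset.sum_add_distrib]
    trans ∑ t : Fin r, 1
    · exact Finset.sum_congr rfl fun t _ => by split_ifs <;> rfl
    · simp
  rw [← hsum, hdiag, Matrix.rank_diagonal] at hrank
  omega

theorem Restricts.le_sliceRank {T : ι1 → ι2 → ι3 → F} {r : ℕ}
    (h : Restricts T (unitTensor F r)) : r ≤ sliceRank T := by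
  obtain ⟨L1, L2, L3, hL⟩ := h
  obtain ⟨f, hf, hT⟩ := exists_isSlice_sum T
  refine le_of_unitTensor_eq_sum
    (fun t a b c => ∑ i, ∑ j, ∑ k, L1 a i * L2 b j * L3 c k * f t i j k) (fun t => ?_) ?_
  · rcases hf t with ⟨x, y, h⟩ | ⟨x, y, h⟩ | ⟨x, y, h⟩
    · refine Or.inl ⟨fun a => ∑ i, L1 a i * x i,
        fun b c => ∑ j, ∑ k, L2 b j * L3 c k * y j k, ?_⟩
      funext a b c
      simp only [h]
      rw [Finset.sum_mul]
      refine Finset.sum_congr rfl fun i _ => ?_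
      rw [Finset.mul_sum]
      refine Finset.sum_congr rfl fun j _ => ?_
      rw [Finset.mul_sum]
      exact Finset.sum_congr rfl fun k _ => by ring
    · refine Or.inr (Or.inl ⟨fun b => ∑ j, L2 b j * x j,
        fun a c => ∑ i, ∑ k, L1 a i * L3 c k * y i k, ?_⟩)
      funext a b c
      simp only [h]
      rw [Finset.sum_comm, Finset.sum_mul]
      refine Finset.sum_congr rfl fun i _ => ?_
      rw [Finset.mul_sum]
      refine Finset.sum_congr rfl fun j _ => ?_
      rw [Finset.mul_sum]
      exact Finset.sum_congr rfl fun k _ => by ring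
    · refine Or.inr (Or.inr ⟨fun c => ∑ k, L3 c k * x k,
        fun a b => ∑ i, ∑ j, L1 a i * L2 b j * y i j, ?_⟩)
      funext a b c
      simp only [h]
      rw [Finset.sum_congr rfl fun i _ => Finset.sum_comm, Finset.sum_comm, Finset.sum_mul]
      refine Finset.sum_congr rfl fun i _ => ?_
      rw [Finset.mul_sum]
      refine Finset.sum_congr rfl fun j _ => ?_
      rw [Finset.mul_sum]
      exact Finset.sum_congr rfl fun k _ => by ring
  · have hT' : ∀ i j k, T i j k = ∑ t, f t i j k := fun i j k => by
      simpa using congrFun (congrFun (congrFun hT i) j) k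
    funext a b c
    simp only [hL, hT', Finset.sum_apply, Finset.mul_sum]
    rw [Finset.sum_comm (s := (Finset.univ : Finset (Fin (sliceRank T))))]
    refine Finset.sum_congr rfl fun i _ => ?_
    rw [Finset.sum_comm (s := (Finset.univ : Finset (Fin (sliceRank T))))]
    refine Finset.sum_congr rfl fun j _ => ?_
    rw [Finset.sum_comm]

theorem bddAbove_restricts (T : ι1 → ι2 → ι3 → F) :
    BddAbove {r : ℕ | Restricts T (unitTensor F r)} :=
  ⟨sliceRank T, fun _ h => h.le_sliceRank⟩

theorem restricts_unitTensor_subrank (T : ι1 → ι2 → ι3 → F) :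
    Restricts T (unitTensor F (subrank T)) :=
  Nat.sSup_mem (s := {r : ℕ | Restricts T (unitTensor F r)})
    ⟨0, fun a => a.elim0, fun a => a.elim0, fun a => a.elim0, fun a => a.elim0⟩
    (bddAbove_restricts T)

theorem subrank_le_sliceRank (T : ι1 → ι2 → ι3 → F) : subrank T ≤ sliceRank T :=
  (restricts_unitTensor_subrank T).le_sliceRank

theorem card_le_subrank {κ : Type*} [Fintype κ] [DecidableEq κ] (T : ι1 → ι2 → ι3 → F)
    (L1 : κ → ι1 → F) (L2 : κ → ι2 → F) (L3 : κ → ι3 → F)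
    (h : ∀ a b c, ∑ i, ∑ j, ∑ k, L1 a i * L2 b j * L3 c k * T i j k =
      if a = b ∧ b = c then 1 else 0) : Fintype.card κ ≤ subrank T := by
  let e := (Fintype.equivFin κ).symm
  refine le_csSup (bddAbove_restricts T) ⟨fun a => L1 (e a), fun a => L2 (e a),
    fun a => L3 (e a), fun a b c => ?_⟩
  rw [h]
  simp [unitTensor]

/-- A contraction of a Kronecker power by product vectors is a product. -/
theorem sum_kronPow (T : ι1 → ι2 → ι3 → F) (m : ℕ) (u : Fin m → ι1 → F) (v : Fin m → ι2 → F)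
    (w : Fin m → ι3 → F) :
    ∑ x, ∑ y, ∑ z, (∏ s, u s (x s)) * (∏ s, v s (y s)) * (∏ s, w s (z s)) * kronPow T m x y z =
      ∏ s, ∑ i, ∑ j, ∑ k, u s i * v s j * w s k * T i j k := by
  classical
  simp only [Finset.prod_univ_sum, Fintype.piFinset_univ, kronPow, Finset.prod_mul_distrib]

theorem subrank_pow_le (T : ι1 → ι2 → ι3 → F) (j : ℕ) :
    subrank T ^ j ≤ subrank (kronPow T j) := by
  obtain ⟨L1, L2, L3, hL⟩ := restricts_unitTensor_subrank T
  have := card_le_subrank (κ := Fin j → Fin (subrank T)) (kronPow T j)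
    (fun a x => ∏ s, L1 (a s) (x s)) (fun b y => ∏ s, L2 (b s) (y s))
    (fun c z => ∏ s, L3 (c s) (z s)) fun a b c => by
      rw [sum_kronPow T j (fun s => L1 (a s)) (fun s => L2 (b s)) fun s => L3 (c s)]
      simp only [← hL, unitTensor, Finset.prod_ite_zero, Finset.prod_const_one]
      simp [funext_iff, forall_and]
  simpa using this

/-- Indices of an iterated Kronecker power. -/
def powIndexEquiv (ι : Type*) (m j : ℕ) : (Fin (j * m) → ι) ≃ (Fin j → Fin m → ι) :=
  (Equiv.arrowCongr finProdFinEquiv.symm (Equiv.refl ι)).trans (Equiv.curry _ _ _)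

theorem subrank_kronPow_kronPow_le (T : ι1 → ι2 → ι3 → F) (m j : ℕ) :
    subrank (kronPow (kronPow T m) j) ≤ subrank (kronPow T (j * m)) := by
  obtain ⟨L1, L2, L3, hL⟩ := restricts_unitTensor_subrank (kronPow (kronPow T m) j)
  refine le_csSup (bddAbove_restricts _) ⟨fun a x => L1 a (powIndexEquiv _ m j x),
    fun a x => L2 a (powIndexEquiv _ m j x),
    fun a x => L3 a (powIndexEquiv _ m j x), fun a b c => ?_⟩
  rw [hL]
  have hE : ∀ x y z, kronPow T (j * m) x y z =
      kronPow (kronPow T m) j (powIndexEquiv _ m j x) (powIndexEquiv _ m j y)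
        (powIndexEquiv _ m j z) := by
    intro x y z
    simp only [kronPow, powIndexEquiv]
    rw [← finProdFinEquiv.prod_comp, Fintype.prod_prod_type]
    rfl
  simp only [hE]
  rw [← (powIndexEquiv ι1 m j).sum_comp]
  refine Finset.sum_congr rfl fun x _ => ?_
  rw [← (powIndexEquiv ι2 m j).sum_comp]
  refine Finset.sum_congr rfl fun y _ => ?_
  rw [← (powIndexEquiv ι3 m j).sum_comp]

/-- The subrank of the third Kronecker power is almost quadratic in the slice rank. -/
theorem mul_rothNumberNat_le_subrank (T : ι1 → ι2 → ι3 → F) {N : ℕ} (hN : 12 * N ≤ sliceRank T) :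
    N * rothNumberNat N ≤ subrank (kronPow T 3) := by
  obtain ⟨A, hAN, hA, hfree⟩ := rothNumberNat_spec N
  have h1 := sliceRank_le_sliceRank_rotate T
  have h2 := sliceRank_le_sliceRank_rotate (rotate T)
  obtain ⟨u₀, v₀, w₀, h₀⟩ := exists_contract_eq_one T (q := 3 * N) (by omega)
  obtain ⟨v₁, w₁, u₁, h₁⟩ := exists_contract_eq_one (rotate T) (q := 3 * N) (by omega)
  obtain ⟨w₂, u₂, v₂, h₂⟩ := exists_contract_eq_one (rotate (rotate T)) (q := 3 * N) (by omega)
  have hlt : ∀ (x : Fin N) (a : A), (a : ℕ) < N := fun x a => Finset.mem_range.1 (hAN a.2)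
  let p₀ : Fin N × A → Fin (3 * N) := fun p => ⟨p.1, by have := hlt p.1 p.2; omega⟩
  let p₁ : Fin N × A → Fin (3 * N) := fun p => ⟨p.1 + p.2, by have := hlt p.1 p.2; omega⟩
  let p₂ : Fin N × A → Fin (3 * N) := fun p => ⟨p.1 + p.2 + p.2, by have := hlt p.1 p.2; omega⟩
  have h := card_le_subrank (κ := Fin N × A) (kronPow T 3)
    (fun p x => ∏ s, ![u₀ (p₁ p), u₁, u₂ (p₀ p)] s (x s))
    (fun p y => ∏ s, ![v₀ (p₁ p), v₁ (p₂ p), v₂] s (y s))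
    (fun p z => ∏ s, ![w₀, w₁ (p₂ p), w₂ (p₀ p)] s (z s)) ?_
  · simpa [hA] using h
  intro p q r
  rw [sum_kronPow, Fin.prod_univ_three]
  have e₀ := h₀ (p₁ p) (p₁ q)
  have e₁ : ∑ i, ∑ j, ∑ k, u₁ i * v₁ (p₂ q) j * w₁ (p₂ r) k * T i j k =
      if p₂ q = p₂ r then 1 else 0 := by
    rw [← h₁]
    rw [Finset.sum_comm]
    refine Finset.sum_congr rfl fun j _ => ?_
    rw [Finset.sum_comm]
    exact Finset.sum_congr rfl fun k _ => Finset.sum_congr rfl fun i _ => by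
      rw [rotate]; ring
  have e₂ : ∑ i, ∑ j, ∑ k, u₂ (p₀ p) i * v₂ j * w₂ (p₀ r) k * T i j k =
      if p₀ r = p₀ p then 1 else 0 := by
    rw [← h₂, Finset.sum_congr rfl fun i _ => Finset.sum_comm, Finset.sum_comm]
    exact Finset.sum_congr rfl fun k _ => Finset.sum_congr rfl fun i _ =>
      Finset.sum_congr rfl fun j _ => by rw [rotate, rotate]; ring
  simp only [Matrix.cons_val_zero, Matrix.cons_val_one, Matrix.cons_val]
  rw [e₀, e₁, e₂]
  have hiff : ((p₁ p = p₁ q ∧ p₂ q = p₂ r) ∧ p₀ r = p₀ p) ↔ p = q ∧ q = r := by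
    obtain ⟨x, a⟩ := p
    obtain ⟨y, b⟩ := q
    obtain ⟨z, c⟩ := r
    rw [threeAPFree_iff_eq_right] at hfree
    simp only [p₀, p₁, p₂, Prod.mk.injEq, Fin.ext_iff, Subtype.ext_iff]
    constructor
    · rintro ⟨⟨h1, h2⟩, h3⟩
      have := hfree a.2 c.2 b.2 (by omega)
      omega
    · omega
  simp only [← hiff, ite_and]
  split_ifs <;> simp

end Slices

/-- Behrend's bound beats any smaller exponential growth rate. -/
theorem eventually_pow_le_mul_rothNumberNat {c d : ℝ} (hd : 1 < d) (hdc : d < c) :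
    ∀ᶠ m : ℕ in Filter.atTop,
      d ^ (2 * m) ≤ ((⌊c ^ m / 12⌋₊ * rothNumberNat ⌊c ^ m / 12⌋₊ : ℕ) : ℝ) := by
  have hc : 1 < c := hd.trans hdc
  have hlog : 0 < Real.log c - Real.log d := sub_pos.2 (Real.log_lt_log (by linarith) hdc)
  have hsqrt : Filter.Tendsto (fun m : ℕ => √(m : ℝ)) Filter.atTop Filter.atTop :=
    Real.tendsto_sqrt_atTop.comp tendsto_natCast_atTop_atTop
  set b := √(Real.log c)
  filter_upwards [(tendsto_pow_atTop_atTop_of_one_lt hc).eventually_ge_atTop 24,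
    hsqrt.eventually_ge_atTop (2 * Real.log 24),
    hsqrt.eventually_ge_atTop ((4 * b + 1) / (2 * (Real.log c - Real.log d)))] with m h24 hm1 hm2
  set N := ⌊c ^ m / 12⌋₊
  have hcm : c ^ m = Real.exp (m * Real.log c) := by
    rw [← Real.log_pow, Real.exp_log (by positivity)]
  have hdm : d ^ (2 * m) = Real.exp (2 * m * Real.log d) := by
    rw [show 2 * m * Real.log d = ((2 * m : ℕ) : ℝ) * Real.log d by push_cast; ring,
      ← Real.log_pow, Real.exp_log (by positivity)]
  have hNlow : c ^ m / 24 ≤ N := by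
    have := Nat.lt_floor_add_one (c ^ m / 12)
    linarith
  have hNpos : (0 : ℝ) < N := by linarith
  have hNup : (N : ℝ) ≤ c ^ m := by
    have := Nat.floor_le (a := c ^ m / 12) (by positivity)
    linarith
  have hlogN : √(Real.log N) ≤ √m * b := by
    rw [← Real.sqrt_mul (Nat.cast_nonneg m), ← Real.log_pow]
    exact Real.sqrt_le_sqrt (Real.log_le_log hNpos hNup)
  have hexp24 : (24 : ℝ) = Real.exp (Real.log 24) := (Real.exp_log (by norm_num)).symm
  have hmm : √(m : ℝ) * √m = m := Real.mul_self_sqrt (Nat.cast_nonneg m)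
  have hmain : 2 * m * Real.log d ≤ 2 * (m * Real.log c - Real.log 24) + -4 * (√m * b) := by
    rw [div_le_iff₀ (by linarith)] at hm2
    nlinarith [mul_le_mul_of_nonneg_left hm2 (Real.sqrt_nonneg (m : ℝ))]
  calc d ^ (2 * m) ≤ Real.exp (2 * (m * Real.log c - Real.log 24) + -4 * (√m * b)) := by
        rw [hdm]
        exact Real.exp_le_exp.2 hmain
    _ = (c ^ m / 24) * ((c ^ m / 24) * Real.exp (-4 * (√m * b))) := by
        rw [hcm, Real.exp_add, two_mul, Real.exp_add, Real.exp_sub, ← hexp24]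
        ring
    _ ≤ N * (N * Real.exp (-4 * √(Real.log N))) := by
        have : -4 * (√m * b) ≤ -4 * √(Real.log N) := by linarith
        gcongr
    _ ≤ _ := by
        rw [Nat.cast_mul]
        gcongr
        exact Behrend.roth_lower_bound

section Asymptotic

variable {ι1 ι2 ι3 : Type*} [Fintype ι1] [Fintype ι2] [Fintype ι3]

theorem one_le_subrank_of_ne_zero {T : ι1 → ι2 → ι3 → F} (hT : T ≠ 0) : 1 ≤ subrank T := by
  classical
  obtain ⟨i, j, k, h⟩ : ∃ i j k, T i j k ≠ 0 := by
    by_contra! h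
    exact hT (funext fun i => funext fun j => funext (h i j))
  have := card_le_subrank (κ := Unit) T (fun _ => Pi.single i (T i j k)⁻¹) (fun _ => Pi.single j 1)
    (fun _ => Pi.single k 1) fun _ _ _ => by
      simp [Pi.single_apply, h]
  simpa using this

theorem ne_zero_of_sliceRank_pos {T : ι1 → ι2 → ι3 → F} (hT : 0 < sliceRank T) : T ≠ 0 := by
  rintro rfl
  have := sliceRank_le_card (fun t : Fin 0 => (t.elim0 : ι1 → ι2 → ι3 → F)) fun t => t.elim0
  rw [Fintype.sum_empty, Fintype.card_fin] at this
  omega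

theorem sliceRank_kronPow_rpow_le (T : ι1 → ι2 → ι3 → F) {m : ℕ} (hm : m ≠ 0) :
    (sliceRank (kronPow T m) : ℝ) ^ ((1 : ℝ) / m) ≤ Fintype.card ι1 := by
  classical
  have h : (sliceRank (kronPow T m) : ℝ) ≤ (Fintype.card ι1 : ℝ) ^ m := by
    have := sliceRank_le_card_left (kronPow T m)
    rw [Fintype.card_fun, Fintype.card_fin] at this
    exact_mod_cast this
  calc _ ≤ ((Fintype.card ι1 : ℝ) ^ m) ^ ((1 : ℝ) / m) := by gcongr
    _ = _ := by rw [one_div, Real.pow_rpow_inv_natCast (Nat.cast_nonneg _) hm]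

theorem isBoundedUnder_sliceRank (T : ι1 → ι2 → ι3 → F) :
    Filter.IsBoundedUnder (· ≤ ·) Filter.atTop
      fun m : ℕ => (sliceRank (kronPow T m) : ℝ) ^ ((1 : ℝ) / m) :=
  Filter.isBoundedUnder_of_eventually_le <| (Filter.eventually_ne_atTop 0).mono fun _ hm =>
    sliceRank_kronPow_rpow_le T hm

theorem isCoboundedUnder_sliceRank (T : ι1 → ι2 → ι3 → F) :
    Filter.IsCoboundedUnder (· ≤ ·) Filter.atTop
      fun m : ℕ => (sliceRank (kronPow T m) : ℝ) ^ ((1 : ℝ) / m) :=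
  Filter.IsCoboundedUnder.of_frequently_ge (a := 0) <|
    Filter.Frequently.of_forall fun m => by positivity

theorem subrank_rpow_le_asympSubrank (T : ι1 → ι2 → ι3 → F) {m : ℕ} (hm : m ≠ 0) :
    (subrank (kronPow T m) : ℝ) ^ ((1 : ℝ) / m) ≤ asympSubrank T := by
  have hle : ∀ k : ℕ, (subrank (kronPow T (k + 1)) : ℝ) ^ ((1 : ℝ) / (k + 1)) ≤
      Fintype.card ι1 := fun k => by
    refine le_trans ?_ (sliceRank_kronPow_rpow_le T k.succ_ne_zero)
    rw [Nat.cast_succ]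
    gcongr
    exact subrank_le_sliceRank _
  obtain ⟨k, rfl⟩ := Nat.exists_eq_succ_of_ne_zero hm
  rw [Nat.cast_succ]
  exact le_ciSup (f := fun k : ℕ => (subrank (kronPow T (k + 1)) : ℝ) ^ ((1 : ℝ) / (k + 1)))
    ⟨_, by rintro _ ⟨k, rfl⟩; exact hle k⟩ k

theorem asympSubrank_le_asympSliceRankSup (T : ι1 → ι2 → ι3 → F) :
    asympSubrank T ≤ asympSliceRankSup T := by
  refine ciSup_le fun m => ?_
  refine Filter.le_limsup_of_frequently_le ?_ (isBoundedUnder_sliceRank T)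
  refine Filter.frequently_atTop.2 fun a => ⟨(a + 1) * (m + 1), by nlinarith, ?_⟩
  set s := subrank (kronPow T (m + 1))
  have h : (s : ℝ) ^ (a + 1) ≤ sliceRank (kronPow T ((a + 1) * (m + 1))) := by
    exact_mod_cast ((subrank_pow_le _ _).trans (subrank_kronPow_kronPow_le T (m + 1) (a + 1))).trans
      (subrank_le_sliceRank _)
  calc (s : ℝ) ^ ((1 : ℝ) / (m + 1))
      = ((s : ℝ) ^ (a + 1)) ^ ((1 : ℝ) / ((a + 1) * (m + 1) : ℕ)) := by
        rw [← Real.rpow_natCast, ← Real.rpow_mul (Nat.cast_nonneg _)]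
        congr 1
        push_cast
        field_simp
    _ ≤ _ := by gcongr

theorem rpow_le_asympSubrank (T : ι1 → ι2 → ι3 → F) {d : ℝ} (hd : 1 < d)
    (hdL : d < asympSliceRankSup T) : d ^ ((2 : ℝ) / 3) ≤ asympSubrank T := by
  obtain ⟨c, hdc, hcL⟩ := exists_between hdL
  have hfreq := Filter.frequently_lt_of_lt_limsup (isCoboundedUnder_sliceRank T) hcL
  obtain ⟨m, hm, hN, hm0⟩ := (hfreq.and_eventually
    ((eventually_pow_le_mul_rothNumberNat hd hdc).and (Filter.eventually_ne_atTop 0))).exists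
  set N := ⌊c ^ m / 12⌋₊
  have hc0 : 0 ≤ c := by linarith
  have hSR : c ^ m ≤ sliceRank (kronPow T m) := by
    rw [one_div] at hm
    simpa only [Real.rpow_inv_natCast_pow (Nat.cast_nonneg _) hm0] using
      pow_le_pow_left₀ hc0 hm.le m
  have h12 : 12 * N ≤ sliceRank (kronPow T m) := by
    have := Nat.floor_le (a := c ^ m / 12) (by positivity)
    have h : (12 : ℝ) * N ≤ sliceRank (kronPow T m) := by linarith
    exact_mod_cast h
  have hsub : d ^ (2 * m) ≤ (subrank (kronPow T (3 * m)) : ℝ) :=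
    hN.trans (Nat.cast_le.2 ((mul_rothNumberNat_le_subrank _ h12).trans
      (subrank_kronPow_kronPow_le T m 3)))
  calc d ^ ((2 : ℝ) / 3) = (d ^ (2 * m)) ^ ((1 : ℝ) / (3 * m : ℕ)) := by
        rw [← Real.rpow_natCast, ← Real.rpow_mul (by linarith)]
        congr 1
        push_cast
        field_simp
    _ ≤ (subrank (kronPow T (3 * m)) : ℝ) ^ ((1 : ℝ) / (3 * m : ℕ)) := by gcongr
    _ ≤ asympSubrank T := subrank_rpow_le_asympSubrank T (by omega)

theorem asympSliceRankSup_rpow_le_asympSubrank (T : ι1 → ι2 → ι3 → F) :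
    (asympSliceRankSup T) ^ ((2 : ℝ) / 3) ≤ asympSubrank T := by
  have hQ : 0 ≤ asympSubrank T := Real.iSup_nonneg fun m => by positivity
  have hL : 0 ≤ asympSliceRankSup T := Filter.le_limsup_of_frequently_le
    (Filter.Frequently.of_forall fun m => by positivity) (isBoundedUnder_sliceRank T)
  rcases hL.eq_or_lt with h0 | h0
  · rw [← h0, Real.zero_rpow (by norm_num)]
    exact hQ
  rcases le_or_gt (asympSliceRankSup T) 1 with h1 | h1
  · refine (Real.rpow_le_one hL h1 (by norm_num)).trans ?_
    obtain ⟨m, hm, hm0⟩ := ((Filter.frequently_lt_of_lt_limsup (isCoboundedUnder_sliceRank T)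
      h0).and_eventually (Filter.eventually_ne_atTop 0)).exists
    have hpos : 0 < sliceRank (kronPow T m) := by
      refine Nat.pos_of_ne_zero fun h => ?_
      rw [h, Nat.cast_zero, Real.zero_rpow (by positivity)] at hm
      exact hm.false
    refine le_trans (Real.one_le_rpow ?_ (by positivity)) (subrank_rpow_le_asympSubrank T hm0)
    exact_mod_cast one_le_subrank_of_ne_zero (ne_zero_of_sliceRank_pos hpos)
  · by_contra! hlt
    have hQL : asympSubrank T ^ ((3 : ℝ) / 2) < asympSliceRankSup T := by
      have := Real.rpow_lt_rpow hQ hlt (z := (3 : ℝ) / 2) (by norm_num)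
      rwa [← Real.rpow_mul hL, show (2 : ℝ) / 3 * (3 / 2) = 1 by norm_num, Real.rpow_one] at this
    obtain ⟨d, hd, hdL⟩ := exists_between (max_lt h1 hQL)
    obtain ⟨hd1, hdQ⟩ := max_lt_iff.1 hd
    have := Real.rpow_lt_rpow (Real.rpow_nonneg hQ _) hdQ (z := (2 : ℝ) / 3) (by norm_num)
    rw [← Real.rpow_mul hQ, show (3 : ℝ) / 2 * (2 / 3) = 1 by norm_num, Real.rpow_one] at this
    exact this.not_ge (rpow_le_asympSubrank T hd1 hdL)

end Asymptotic

/-- `limsup_m SR(T^{⊠m})^{1/m} ≥ Q~(T) ≥ (limsup_m SR(T^{⊠m})^{1/m})^{2/3}`. -/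
theorem asympSubrank_between_sliceRank_bounds (F : Type*) [Field F] (n1 n2 n3 : ℕ)
    (T : Fin n1 → Fin n2 → Fin n3 → F) :
    asympSubrank T ≤ asympSliceRankSup T ∧
      (asympSliceRankSup T) ^ ((2 : ℝ) / 3) ≤ asympSubrank T := by
  exact ⟨asympSubrank_le_asympSliceRankSup T, asympSliceRankSup_rpow_le_asympSubrank T⟩

end Paper
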